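/- Let Z have the Borel distribution with parameter h ∈ (0,1), i.e. P(Z=k) = e^{−hk}(hk)^{k−1}/k! for k = 1,2,…, and set ν = h − 1 − log h. Then for every integer m ≥ 3, E[Z^m] ≤ ((m−1)!/(h√(2π))) (ν^{−m} + 2/π^m + 1/(π(m−1)(m−1)!)). -/

import Mathlib

open Real

open Complex in
/-- The Lipschitz formula on the imaginary axis. -/
lemma lipschitz_formula_imaginary_axis {k : ℕ} (hk : 1 ≤ k) {ν : ℝ} (hν : 0 < ν) :
    ∑' n : ℤ, 1 / (((ν / (2 * π) : ℝ) * I : ℂ) + n) ^ (k + 1) =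
      ((-2 * π * I) ^ (k + 1) / (Nat.factorial k : ℂ)) *
        ((∑' n : ℕ, (n : ℝ) ^ k * Real.exp (-ν) ^ n : ℝ) : ℂ) := by
  have hy : 0 < ν / (2 * π) := by positivity
  have h := EisensteinSeries.qExpansion_identity hk
    ⟨((ν / (2 * π) : ℝ) * I : ℂ), by rwa [im_ofReal_mul, I_im, mul_one]⟩
  have hq : 2 * (π : ℂ) * I * ((ν / (2 * π) : ℝ) * I) = ((-ν : ℝ) : ℂ) := by
    have hpi : (π : ℂ) ≠ 0 := by exact_mod_cast Real.pi_ne_zero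
    push_cast
    field_simp
    linear_combination (ν : ℂ) * I_sq
  dsimp only at h
  rw [h, hq]
  push_cast
  rfl

lemma hasSum_ite_zero_inv_sq (c : ℝ) :
    HasSum (fun n : ℤ ↦ if n = 0 then c else 1 / (n : ℝ) ^ 2) (c + π ^ 2 / 3) := by
  have hz : HasSum (fun n : ℕ ↦ 1 / ((n : ℝ) + 1) ^ 2) (π ^ 2 / 6) := by
    simpa using (hasSum_nat_add_iff' 1).mpr hasSum_zeta_two
  have key := HasSum.of_add_one_of_neg_add_one
    (f := fun n : ℤ ↦ if n = 0 then c else 1 / (n : ℝ) ^ 2) (m := π ^ 2 / 6) (m' := π ^ 2 / 6)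
    (by
      refine hz.congr_fun ?_
      intro n
      rw [if_neg (by omega)]
      push_cast
      rfl)
    (by
      refine hz.congr_fun ?_
      intro n
      rw [if_neg (by omega)]
      push_cast
      rw [neg_sq])
  convert key using 1
  simp only [if_true]
  ring

open Complex in
lemma norm_one_div_add_int_pow_le {y : ℝ} (hy : 0 < y) {m : ℕ} (hm : 2 ≤ m) (n : ℤ) :
    ‖1 / ((y * I : ℂ) + n) ^ m‖ ≤ if n = 0 then 1 / y ^ m else 1 / (n : ℝ) ^ 2 := by
  split_ifs with hn
  · simp [hn, abs_of_pos hy]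
  · have h1 : (1 : ℝ) ≤ |(n : ℝ)| := by exact_mod_cast Int.one_le_abs hn
    have h2 : |(n : ℝ)| ≤ ‖(y * I : ℂ) + n‖ := by
      simpa using abs_re_le_norm ((y * I : ℂ) + n)
    rw [norm_div, norm_one, norm_pow, ← sq_abs (n : ℝ)]
    gcongr
    calc |(n : ℝ)| ^ 2 ≤ |(n : ℝ)| ^ m := pow_le_pow_right₀ h1 hm
      _ ≤ _ := by gcongr

/-- A bound for the polylogarithm of negative integer order. -/
lemma tsum_pow_mul_exp_neg_pow_le {k : ℕ} (hk : 1 ≤ k) {ν : ℝ} (hν : 0 < ν) :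
    ∑' n : ℕ, (n : ℝ) ^ k * Real.exp (-ν) ^ n ≤
      (Nat.factorial k : ℝ) * (1 / ν ^ (k + 1) + 2 / π ^ (k + 1)) := by
  have hy : 0 < ν / (2 * π) := by positivity
  have hb := tsum_of_norm_bounded (hasSum_ite_zero_inv_sq (1 / (ν / (2 * π)) ^ (k + 1)))
    (norm_one_div_add_int_pow_le hy (m := k + 1) (by omega))
  have h0 : 0 ≤ ∑' n : ℕ, (n : ℝ) ^ k * Real.exp (-ν) ^ n := tsum_nonneg fun n ↦ by positivity
  rw [lipschitz_formula_imaginary_axis hk hν] at hb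
  set S := ∑' n : ℕ, (n : ℝ) ^ k * Real.exp (-ν) ^ n
  have hn : ‖((-2 * π * Complex.I) ^ (k + 1) / (Nat.factorial k : ℂ)) * (S : ℂ)‖ =
      (2 * π) ^ (k + 1) / (Nat.factorial k : ℝ) * S := by
    simp [abs_of_pos Real.pi_pos, abs_of_nonneg h0]
  rw [hn] at hb
  have hf : (0 : ℝ) < Nat.factorial k := by positivity
  have hpi : π ^ 2 / 3 ≤ 2 * 2 ^ (k + 1) := by
    have h2 : (2 : ℝ) ^ 2 ≤ 2 ^ (k + 1) := pow_le_pow_right₀ (by norm_num) (by omega)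
    nlinarith [Real.pi_pos, Real.pi_le_four]
  calc S = (Nat.factorial k : ℝ) / (2 * π) ^ (k + 1) *
        ((2 * π) ^ (k + 1) / (Nat.factorial k : ℝ) * S) := by field_simp
    _ ≤ (Nat.factorial k : ℝ) / (2 * π) ^ (k + 1) *
        (1 / (ν / (2 * π)) ^ (k + 1) + 2 * 2 ^ (k + 1)) := by
      gcongr
      linarith
    _ = _ := by
      rw [div_pow, mul_pow]
      field_simp

lemma borel_mul_pow_le {h : ℝ} (hh0 : 0 < h) (k j : ℕ) :
    (Real.exp (-h * (k + 1)) * (h * (k + 1)) ^ k / (Nat.factorial (k + 1) : ℝ))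
        * ((k : ℝ) + 1) ^ (j + 1) ≤
      1 / (h * √(2 * π)) *
        (((k + 1 : ℕ) : ℝ) ^ j * Real.exp (-(h - 1 - Real.log h)) ^ (k + 1)) := by
  have hst := Stirling.le_factorial_stirling (k + 1)
  have hexp : Real.exp (-(h - 1 - Real.log h)) = Real.exp (-h) * Real.exp 1 * h := by
    rw [show -(h - 1 - Real.log h) = -h + 1 + Real.log h by ring, Real.exp_add, Real.exp_add,
      Real.exp_log hh0]
  have hexp' : Real.exp (-h * (k + 1)) = Real.exp (-h) ^ (k + 1) := by
    rw [← Real.exp_nat_mul]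
    push_cast
    ring_nf
  rw [hexp, hexp']
  push_cast at hst ⊢
  set x : ℝ := (k : ℝ) + 1 with hx
  have hx1 : 1 ≤ x := by simp [hx]
  have hst' : √(2 * π) * (x / Real.exp 1) ^ (k + 1) ≤ (Nat.factorial (k + 1) : ℝ) := by
    refine le_trans ?_ hst
    gcongr ?_ * _
    exact Real.sqrt_le_sqrt (le_mul_of_one_le_right (by positivity) hx1)
  have hf : (0 : ℝ) < Nat.factorial (k + 1) := by positivity
  have hs : 0 < √(2 * π) := by positivity
  rw [div_mul_eq_mul_div, div_le_iff₀ hf]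
  calc Real.exp (-h) ^ (k + 1) * (h * x) ^ k * x ^ (j + 1)
    _ = 1 / (h * √(2 * π)) * (x ^ j * (Real.exp (-h) * Real.exp 1 * h) ^ (k + 1)) *
        (√(2 * π) * (x / Real.exp 1) ^ (k + 1)) := by
      rw [mul_pow, mul_pow, mul_pow, div_pow]
      field_simp
      ring
    _ ≤ _ := by gcongr

/-- If `Z` has the Borel distribution with parameter `h ∈ (0,1)` and `ν = h - 1 - log h`,
then for every integer `m ≥ 3`,
`E[Z^m] ≤ ((m-1)!/(h√(2π))) (ν^{-m} + 2/π^m + 1/(π(m-1)(m-1)!))`. -/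
theorem stmt_15 (h : ℝ) (hh0 : 0 < h) (hh1 : h < 1) (m : ℕ) (hm : 3 ≤ m) :
    (∑' k : ℕ,
        (Real.exp (-h * (k + 1)) * (h * (k + 1)) ^ k / (Nat.factorial (k + 1) : ℝ))
          * ((k : ℝ) + 1) ^ m)
      ≤ ((Nat.factorial (m - 1) : ℝ) / (h * Real.sqrt (2 * π)))
          * (1 / (h - 1 - Real.log h) ^ m + 2 / π ^ m
              + 1 / (π * (m - 1 : ℝ) * (Nat.factorial (m - 1) : ℝ))) := by
  obtain ⟨j, rfl⟩ : ∃ j, m = j + 1 := ⟨m - 1, by omega⟩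
  have hν : 0 < h - 1 - Real.log h := by
    linarith [Real.log_lt_sub_one_of_pos hh0 hh1.ne]
  have hsum : Summable fun n : ℕ ↦ (n : ℝ) ^ j * Real.exp (-(h - 1 - Real.log h)) ^ n :=
    summable_pow_mul_geometric_of_norm_lt_one j (by
      rw [Real.norm_of_nonneg (Real.exp_pos _).le]
      exact Real.exp_lt_one_iff.mpr (by linarith))
  have hshift := hsum.tsum_eq_zero_add
  rw [Nat.cast_zero, zero_pow (by omega), zero_mul, zero_add] at hshift
  have hmaj := ((summable_nat_add_iff 1).mpr hsum).mul_left (1 / (h * √(2 * π)))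
  have hle := borel_mul_pow_le hh0
  have hsum' := Summable.of_nonneg_of_le (fun k ↦ by positivity) (fun k ↦ hle k j) hmaj
  have hrem : 0 ≤ 1 / (π * (((j + 1 : ℕ) : ℝ) - 1) * (Nat.factorial j : ℝ)) := by
    push_cast
    rw [add_sub_cancel_right]
    positivity
  rw [Nat.add_sub_cancel]
  calc _ ≤ _ := hsum'.tsum_le_tsum (fun k ↦ hle k j) hmaj
    _ = 1 / (h * √(2 * π)) *
        ∑' n : ℕ, (n : ℝ) ^ j * Real.exp (-(h - 1 - Real.log h)) ^ n := by
      rw [tsum_mul_left, hshift]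
    _ ≤ 1 / (h * √(2 * π)) * ((Nat.factorial j : ℝ) *
        (1 / (h - 1 - Real.log h) ^ (j + 1) + 2 / π ^ (j + 1))) := by
      gcongr
      exact tsum_pow_mul_exp_neg_pow_le (by omega) hν
    _ = (Nat.factorial j : ℝ) / (h * √(2 * π)) *
        (1 / (h - 1 - Real.log h) ^ (j + 1) + 2 / π ^ (j + 1)) := by ring
    _ ≤ _ := by
      gcongr _ * ?_
      linarith
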